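/- arXiv:2406.12941 — 2 statements merged into one kernel-verified Lean document; each statement's English description precedes it below -/
import Mathlib

section
/- Let m ≤ n be positive integers. If α ∈ [n]^m is an (m,n)-parking function, then α is a t-metered (m,n)-parking function for every integer t ≥ 0. -/
/-- One step of the `t`-metered parking process on spots `1,…,n`:
given the outcome list `prev` for the cars that have already entered
(`prev[j-1] = some s` if car `j` parked in spot `s`, `none` if it failed to park),
compute the outcome list after the next car (with preference `pref`) tries to park.
When the next car enters, the occupied spots are exactly the spots of the previous
`t` cars that are still on the street (all earlier cars have already left), and the
entering car parks in the smallest unoccupied spot `≥ pref` among `1,…,n`, if any. -/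
def parkStep (n t : ℕ) (prev : List (Option ℕ)) (pref : ℕ) : List (Option ℕ) :=
  let occ : List ℕ := (prev.drop (prev.length - t)).filterMap id
  prev ++ [((List.range' pref (n + 1 - pref)).filter (fun s => decide (s ∉ occ))).head?]

/-- The outcome of the `t`-metered parking process on spots `1,…,n` for the
preference list `l` (car `i` prefers spot `l[i-1]`); the `i`-th entry is
`some s` if car `i` parks in spot `s`, and `none` if car `i` fails to park. -/
def parkOutcome (n t : ℕ) (l : List ℕ) : List (Option ℕ) :=
  l.foldl (parkStep n t) []

/-- `l` is a `t`-metered `(m,n)`-parking function: a preference list in `[n]^m`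
under which every car parks in the `t`-metered parking scheme. -/
def MeteredPF (m n t : ℕ) (l : List ℕ) : Prop :=
  l.length = m ∧ (∀ x ∈ l, x ∈ Finset.Icc 1 n) ∧
    ∀ o ∈ parkOutcome n t l, o.isSome

/-- `l` is a classical `(m,n)`-parking function: a preference list in `[n]^m` under
which every car parks when no car ever leaves (equivalently, the `t`-metered scheme
with `t = m`, under which no car leaves while cars are still arriving). -/
def ParkingFunction (m n : ℕ) (l : List ℕ) : Prop :=
  l.length = m ∧ (∀ x ∈ l, x ∈ Finset.Icc 1 n) ∧
    ∀ o ∈ parkOutcome n m l, o.isSome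

open Finset in
/-- If `M` has at most as many elements as `S` above every threshold, and `M` contains the
interval `[p, k)` whose least element `p` is missing from `S`, then above `k` the set `S` has
strictly more elements. -/
lemma card_filter_le_lt_of_Ico_subset {M S : Finset ℕ}
    (h : ∀ j, #{x ∈ M | j ≤ x} ≤ #{x ∈ S | j ≤ x}) {p k : ℕ} (hpS : p ∉ S) (hpk : p < k)
    (hM : Ico p k ⊆ M) : #{x ∈ M | k ≤ x} < #{x ∈ S | k ≤ x} := by
  have hMp : #(Ico p k) + #{x ∈ M | k ≤ x} ≤ #{x ∈ M | p ≤ x} := by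
    rw [← card_union_of_disjoint]
    · refine card_le_card fun x hx => ?_
      simp only [mem_union, mem_filter, mem_Ico] at hx ⊢
      rcases hx with hx | hx
      · exact ⟨hM (mem_Ico.2 hx), hx.1⟩
      · exact ⟨hx.1, by omega⟩
    · rw [disjoint_left]
      intro x hx hx'
      simp only [mem_filter, mem_Ico] at hx hx'
      omega
  have hSp : #{x ∈ S | p ≤ x} ≤ #(Ico (p + 1) k) + #{x ∈ S | k ≤ x} := by
    refine (card_le_card fun x hx => ?_).trans (card_union_le _ _)
    simp only [mem_union, mem_filter, mem_Ico] at hx ⊢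
    have : x ≠ p := fun e => hpS (e ▸ hx.1)
    by_cases hxk : k ≤ x
    · exact Or.inr ⟨hx.1, hxk⟩
    · exact Or.inl (by omega)
  have := h p
  rw [Nat.card_Ico] at hMp hSp
  omega

open Finset in
/-- Parking one more car with preference `a` in both `M` (at `s`) and `S` (at `p`) preserves the
domination of `M` by `S` above every threshold. -/
lemma card_filter_insert_le_card_filter_insert {M S : Finset ℕ}
    (h : ∀ j, #{x ∈ M | j ≤ x} ≤ #{x ∈ S | j ≤ x}) {a p s : ℕ} (hpS : p ∉ S) (hap : a ≤ p)
    (hM : ∀ x, a ≤ x → x < s → x ∈ M) (k : ℕ) :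
    #{x ∈ insert s M | k ≤ x} ≤ #{x ∈ insert p S | k ≤ x} := by
  have hk := h k
  have hle : #{x ∈ S | k ≤ x} ≤ #{x ∈ insert p S | k ≤ x} :=
    card_le_card (filter_subset_filter _ (subset_insert _ _))
  by_cases hks : k ≤ s
  · have hMs : #{x ∈ insert s M | k ≤ x} ≤ #{x ∈ M | k ≤ x} + 1 := by
      rw [filter_insert, if_pos hks]
      exact card_insert_le _ _
    by_cases hkp : k ≤ p
    · rw [filter_insert _ p, if_pos hkp, card_insert_of_notMem (by simp [hpS])]
      omega
    · have := card_filter_le_lt_of_Ico_subset h hpS (not_le.1 hkp) fun x hx => by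
        rw [mem_Ico] at hx
        exact hM x (hap.trans hx.1) (hx.2.trans_le hks)
      omega
  · rw [filter_insert _ s, if_neg hks]
    omega

/-- The spots occupied when the next car enters, given the outcomes of the previous cars. -/
def occupied (t : ℕ) (prev : List (Option ℕ)) : Finset ℕ :=
  ((prev.drop (prev.length - t)).filterMap id).toFinset

lemma mem_occupied {t x : ℕ} {prev : List (Option ℕ)} :
    x ∈ occupied t prev ↔ some x ∈ prev.drop (prev.length - t) := by
  simp [occupied]

lemma occupied_append_subset (t s : ℕ) (prev : List (Option ℕ)) :
    occupied t (prev ++ [some s]) ⊆ insert s (occupied t prev) := by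
  intro x hx
  rw [mem_occupied, List.drop_append, List.mem_append] at hx
  rw [Finset.mem_insert, mem_occupied]
  rcases hx with hx | hx
  · refine Or.inr (List.drop_subset_drop_left _ ?_ hx)
    simp
    omega
  · exact Or.inl (by simpa using List.mem_of_mem_drop hx)

lemma occupied_append_of_length_lt {m s : ℕ} {prev : List (Option ℕ)} (h : prev.length < m) :
    occupied m (prev ++ [some s]) = insert s (occupied m prev) := by
  ext x
  rw [Finset.mem_insert, mem_occupied, mem_occupied, Nat.sub_eq_zero_of_le h.le,
    Nat.sub_eq_zero_of_le (by simpa using h)]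
  simp [or_comm]

/-- The spot taken by a car with preference `a` when the spots in `occ` are occupied. -/
def parkSpot (n : ℕ) (occ : Finset ℕ) (a : ℕ) : Option ℕ :=
  (List.range' a (n + 1 - a)).find? fun s => decide (s ∉ occ)

lemma parkStep_eq (n t : ℕ) (prev : List (Option ℕ)) (a : ℕ) :
    parkStep n t prev a = prev ++ [parkSpot n (occupied t prev) a] := by
  simp [parkStep, parkSpot, occupied, List.head?_filter]

lemma parkSpot_eq_some {n a s : ℕ} {occ : Finset ℕ} (h : parkSpot n occ a = some s) :
    s ∉ occ ∧ a ≤ s ∧ s ≤ n ∧ ∀ x, a ≤ x → x < s → x ∈ occ := by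
  rw [parkSpot, List.find?_range'_eq_some] at h
  simp only [decide_eq_true_eq, List.mem_range'_1, decide_not, Bool.not_not] at h
  exact ⟨by simpa using h.1, h.2.1.1, by omega, h.2.2⟩

lemma parkSpot_eq_none {n a : ℕ} {occ : Finset ℕ} (h : parkSpot n occ a = none) :
    ∀ x, a ≤ x → x ≤ n → x ∈ occ := by
  rw [parkSpot, List.find?_eq_none] at h
  intro x hax hxn
  simpa using h x (by rw [List.mem_range'_1]; omega)

lemma parkOutcome_append_singleton (n t : ℕ) (l : List ℕ) (a : ℕ) :
    parkOutcome n t (l ++ [a]) =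
      parkOutcome n t l ++ [parkSpot n (occupied t (parkOutcome n t l)) a] := by
  rw [← parkStep_eq]
  simp [parkOutcome]

lemma length_parkOutcome (n t : ℕ) (l : List ℕ) : (parkOutcome n t l).length = l.length := by
  induction l using List.reverseRecOn with
  | nil => rfl
  | append_singleton l a ih => simp [parkOutcome_append_singleton, ih]

open Finset in
/-- If all cars park when none leaves, then they all park in the `t`-metered scheme, and above
every threshold the metered scheme occupies at most as many spots. -/
lemma isSome_parkOutcome_and_card_occupied_le (m n t : ℕ) (l : List ℕ) (hl : l.length ≤ m)
    (h : ∀ o ∈ parkOutcome n m l, o.isSome) :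
    (∀ o ∈ parkOutcome n t l, o.isSome) ∧
      (∀ x ∈ occupied m (parkOutcome n m l), x ≤ n) ∧
      ∀ k, #{x ∈ occupied t (parkOutcome n t l) | k ≤ x} ≤
        #{x ∈ occupied m (parkOutcome n m l) | k ≤ x} := by
  induction l using List.reverseRecOn with
  | nil => simp [parkOutcome, occupied]
  | append_singleton l a ih =>
    rw [List.length_append, List.length_singleton] at hl
    rw [parkOutcome_append_singleton n m] at h ⊢
    obtain ⟨hsome, hbound, hcard⟩ := ih (by omega) fun o ho => h o (List.mem_append_left _ ho)
    obtain ⟨p, hp⟩ := Option.isSome_iff_exists.1 (h _ (List.mem_append_right _ (List.mem_singleton_self _)))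
    obtain ⟨hpS, hap, hpn, -⟩ := parkSpot_eq_some hp
    rw [hp, occupied_append_of_length_lt (by rw [length_parkOutcome]; omega),
      parkOutcome_append_singleton n t]
    cases hs : parkSpot n (occupied t (parkOutcome n t l)) a with
    | none =>
      have hlt := card_filter_le_lt_of_Ico_subset hcard hpS (Nat.lt_succ_of_le hpn) fun x hx => by
        rw [mem_Ico] at hx
        exact parkSpot_eq_none hs x (by omega) (by omega)
      obtain ⟨x, hx⟩ := card_pos.1 (Nat.zero_lt_of_lt hlt)
      rw [mem_filter] at hx
      have := hbound x hx.1
      omega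
    | some s =>
      obtain ⟨-, -, -, hM⟩ := parkSpot_eq_some hs
      refine ⟨fun o ho => ?_, fun x hx => ?_, fun k => ?_⟩
      · rcases List.mem_append.1 ho with ho | ho
        · exact hsome o ho
        · simp [List.mem_singleton.1 ho]
      · rcases mem_insert.1 hx with rfl | hx
        · exact hpn
        · exact hbound x hx
      · exact (card_le_card (filter_subset_filter _ (occupied_append_subset _ _ _))).trans
          (card_filter_insert_le_card_filter_insert hcard hpS hap hM k)

/-- For `m ≤ n`, if `α ∈ [n]^m` is an `(m,n)`-parking function, then `α`
is a `t`-metered `(m,n)`-parking function for every integer `t ≥ 0`. -/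
theorem classical_is_metered (m n : ℕ) (hm : 1 ≤ m) (hmn : m ≤ n) (l : List ℕ)
    (h : ParkingFunction m n l) :
    ∀ t : ℕ, MeteredPF m n t l := by
  intro t
  obtain ⟨hlen, hmem, hpark⟩ := h
  exact ⟨hlen, hmem, (isSome_parkOutcome_and_card_occupied_le m n t l hlen.le hpark).1⟩
end

section
/- For every integer m > 2, the number of 1-metered (m,2)-parking functions is mpf_{m,2}(1) = 2^{(m+1)/2} if m is odd, and mpf_{m,2}(1) = 3 · 2^{m/2 − 1} if m is even. -/
theorem foldl_parkStep_one_append (n : ℕ) (l : List ℕ) (p : List (Option ℕ)) (o : Option ℕ) :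
    l.foldl (parkStep n 1) (p ++ [o]) = p ++ l.foldl (parkStep n 1) [o] := by
  induction l generalizing p o with
  | nil => rfl
  | cons a l ih =>
    have h : ∀ q : List (Option ℕ), parkStep n 1 (q ++ [o]) a =
        (q ++ [o]) ++ [((List.range' a (n + 1 - a)).filter
          (fun s => decide (s ∉ [o].filterMap id))).head?] := by
      intro q
      simp [parkStep]
    have h0 := h []
    rw [List.nil_append] at h0
    rw [List.foldl_cons, List.foldl_cons, h p, h0, ih, ih, List.append_assoc]

/-- The preference lists of length `k` under which every car parks in the `1`-metered scheme on
two spots, when the car that entered just before them is in spot `s`. -/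
def meteredFrom (s k : ℕ) : Set (List ℕ) :=
  {l | l.length = k ∧ (∀ x ∈ l, x ∈ Finset.Icc 1 2) ∧
    ∀ o ∈ l.foldl (parkStep 2 1) [some s], o.isSome}

theorem meteredFrom_zero (s : ℕ) : meteredFrom s 0 = {[]} := by
  ext l
  constructor
  · rintro ⟨h, -⟩
    exact List.length_eq_zero_iff.mp h
  · rintro rfl
    simp [meteredFrom]

theorem forall_isSome_foldl_cons (s a : ℕ) (l : List ℕ) (o : Option ℕ)
    (h : parkStep 2 1 [some s] a = [some s] ++ [o]) :
    (∀ x ∈ (a :: l).foldl (parkStep 2 1) [some s], x.isSome) ↔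
      ∀ x ∈ l.foldl (parkStep 2 1) [o], x.isSome := by
  rw [List.foldl_cons, h, foldl_parkStep_one_append]
  simp

theorem not_forall_isSome_foldl_none (l : List ℕ) :
    ¬ ∀ x ∈ l.foldl (parkStep 2 1) [none], x.isSome := by
  cases l with
  | nil => simp
  | cons a l =>
    obtain ⟨o, h⟩ : ∃ o, parkStep 2 1 [none] a = [none] ++ [o] := ⟨_, rfl⟩
    rw [List.foldl_cons, h, foldl_parkStep_one_append]
    simp

theorem meteredFrom_one_succ (k : ℕ) :
    meteredFrom 1 (k + 1) =
      List.cons 1 '' meteredFrom 2 k ∪ List.cons 2 '' meteredFrom 2 k := by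
  ext l
  cases l with
  | nil => simp [meteredFrom]
  | cons a l =>
    have h1 := forall_isSome_foldl_cons 1 1 l (some 2) (by decide)
    have h2 := forall_isSome_foldl_cons 1 2 l (some 2) (by decide)
    have ha : a ∈ Finset.Icc 1 2 ↔ a = 1 ∨ a = 2 := by rw [Finset.mem_Icc]; omega
    simp only [meteredFrom, Set.mem_ofPred_eq, Set.mem_union, Set.mem_image, List.cons.injEq,
      List.length_cons, List.forall_mem_cons, ha, add_left_inj]
    grind

theorem meteredFrom_two_succ (k : ℕ) :
    meteredFrom 2 (k + 1) = List.cons 1 '' meteredFrom 1 k := by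
  ext l
  cases l with
  | nil => simp [meteredFrom]
  | cons a l =>
    have h1 := forall_isSome_foldl_cons 2 1 l (some 1) (by decide)
    have h2 := forall_isSome_foldl_cons 2 2 l none (by decide)
    have h3 := not_forall_isSome_foldl_none l
    have ha : a ∈ Finset.Icc 1 2 ↔ a = 1 ∨ a = 2 := by rw [Finset.mem_Icc]; omega
    simp only [meteredFrom, Set.mem_ofPred_eq, Set.mem_image, List.cons.injEq,
      List.length_cons, List.forall_mem_cons, ha, add_left_inj]
    grind

theorem setOf_meteredPF_succ (k : ℕ) :
    {l : List ℕ | MeteredPF (k + 1) 2 1 l} =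
      List.cons 1 '' meteredFrom 1 k ∪ List.cons 2 '' meteredFrom 2 k := by
  ext l
  cases l with
  | nil => simp [MeteredPF, meteredFrom]
  | cons a l =>
    have h1 : parkOutcome 2 1 (1 :: l) = l.foldl (parkStep 2 1) [some 1] := by
      rw [parkOutcome, List.foldl_cons, show parkStep 2 1 [] 1 = [some 1] by decide]
    have h2 : parkOutcome 2 1 (2 :: l) = l.foldl (parkStep 2 1) [some 2] := by
      rw [parkOutcome, List.foldl_cons, show parkStep 2 1 [] 2 = [some 2] by decide]
    have ha : a ∈ Finset.Icc 1 2 ↔ a = 1 ∨ a = 2 := by rw [Finset.mem_Icc]; omega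
    simp only [meteredFrom, MeteredPF, Set.mem_ofPred_eq, Set.mem_union, Set.mem_image,
      List.cons.injEq, List.length_cons, List.forall_mem_cons, ha, add_left_inj]
    grind

theorem encard_image_cons_union {α : Type*} {a b : α} (hab : a ≠ b) (S T : Set (List α)) :
    (List.cons a '' S ∪ List.cons b '' T).encard = S.encard + T.encard := by
  rw [Set.encard_union_eq, List.cons_injective.encard_image, List.cons_injective.encard_image]
  rw [Set.disjoint_left]
  rintro _ ⟨x, -, rfl⟩ ⟨y, -, h⟩
  exact hab (List.cons.inj h).1.symm

theorem encard_meteredFrom_one_succ (k : ℕ) :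
    (meteredFrom 1 (k + 1)).encard = 2 * (meteredFrom 2 k).encard := by
  rw [meteredFrom_one_succ, encard_image_cons_union (by decide), two_mul]

theorem encard_meteredFrom_two_succ (k : ℕ) :
    (meteredFrom 2 (k + 1)).encard = (meteredFrom 1 k).encard := by
  rw [meteredFrom_two_succ, List.cons_injective.encard_image]

theorem encard_meteredFrom_even (k : ℕ) :
    (meteredFrom 1 (2 * k)).encard = 2 ^ k ∧ (meteredFrom 2 (2 * k)).encard = 2 ^ k := by
  induction k with
  | zero => simp [meteredFrom_zero]
  | succ k ih =>
    rw [show 2 * (k + 1) = 2 * k + 1 + 1 by ring, encard_meteredFrom_one_succ,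
      encard_meteredFrom_two_succ, encard_meteredFrom_two_succ, encard_meteredFrom_one_succ,
      ih.1, ih.2, pow_succ']
    exact ⟨rfl, rfl⟩

/-- For every integer `m > 2`, the number of `1`-metered
`(m,2)`-parking functions is `2^((m+1)/2)` if `m` is odd, and `3·2^(m/2 - 1)` if `m`
is even. -/
theorem mpf_one_metered_two_spots (m : ℕ) (hm : 2 < m) :
    Set.ncard {l : List ℕ | MeteredPF m 2 1 l} =
      if Odd m then 2 ^ ((m + 1) / 2) else 3 * 2 ^ (m / 2 - 1) := by
  obtain ⟨k, rfl⟩ : ∃ k, m = k + 1 := ⟨m - 1, by omega⟩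
  rw [setOf_meteredPF_succ, Set.ncard, encard_image_cons_union (by decide)]
  obtain ⟨j, rfl | rfl⟩ := k.even_or_odd'
  · rw [if_pos (odd_two_mul_add_one j), (encard_meteredFrom_even j).1,
      (encard_meteredFrom_even j).2, show (2 * j + 1 + 1) / 2 = j + 1 by omega,
      show (2 : ℕ∞) ^ j + 2 ^ j = ((2 ^ (j + 1) : ℕ) : ℕ∞) by push_cast; ring]
    rfl
  · rw [if_neg (by rw [Nat.not_odd_iff_even]; exact ⟨j + 1, by ring⟩),
      encard_meteredFrom_one_succ, encard_meteredFrom_two_succ, (encard_meteredFrom_even j).1,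
      (encard_meteredFrom_even j).2, show (2 * j + 1 + 1) / 2 - 1 = j by omega,
      show (2 : ℕ∞) * 2 ^ j + 2 ^ j = ((3 * 2 ^ j : ℕ) : ℕ∞) by push_cast; ring]
    rfl
end
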